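/- Let d ∈ ℕ, T ∈ [0,∞), φ ∈ C(ℝ^d,[0,∞)), let ‖·‖ be a norm on ℝ^d, let z^x ∈ C([0,T],ℝ^d), x ∈ ℝ^d, be functions such that for every t ∈ [0,T] the map x ↦ z^x(t) is in C¹(ℝ^d,ℝ^d), and assume for all x ∈ ℝ^d, t ∈ [0,T], and all h ∈ ℝ^d such that the map [0,T] ∋ s ↦ (∂/∂x z^x(s))(h) ∈ ℝ^d is ℬ([0,T])/ℬ(ℝ^d)-measurable, that ∫₀^T ‖(∂/∂x z^x(s))(h)‖ ds < ∞ and ‖(∂/∂x z^x(t))(h)‖ ≤ ‖h‖ + ∫₀^t φ(z^x(s))·‖(∂/∂x z^x(s))(h)‖ ds. Then for all x,y ∈ ℝ^d and t ∈ [0,T] it holds that ‖z^x(t) − z^y(t)‖ ≤ sup_{u∈[0,1]} [ ‖x−y‖ · exp( T · sup_{s∈[0,T]} φ(z^{(1−u)y+ux}(s)) ) ]. -/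

import Mathlib

open MeasureTheory ProbabilityTheory Filter
open scoped ENNReal NNReal

noncomputable section

/-- `N` is a norm on the real vector space `E`. -/
def IsNorm {E : Type*} [AddCommGroup E] [Module ℝ E] (N : E → ℝ) : Prop :=
  (∀ x, N x = 0 ↔ x = 0) ∧ (∀ (a : ℝ) (x : E), N (a • x) = |a| * N x) ∧
    ∀ x y, N (x + y) ≤ N x + N y

section

open Set Topology

theorem integral_gronwall {f : ℝ → ℝ} {a M t : ℝ} (hM : 0 ≤ M) (ht : 0 ≤ t)
    (hf : Integrable f) (h : ∀ s ∈ Icc 0 t, f s ≤ a + M * ∫ r in (0 : ℝ)..s, f r) :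
    f t ≤ a * Real.exp (M * t) := by
  have hF : Continuous fun s => ∫ r in (0 : ℝ)..s, f r :=
    intervalIntegral.continuous_primitive (fun _ _ => hf.intervalIntegrable) 0
  set G : ℝ → ℝ := fun s => a + M * ∫ r in (0 : ℝ)..s, f r with hG
  have hGc : Continuous G := by fun_prop
  set H : ℝ → ℝ := fun s => ∫ r in (0 : ℝ)..s, G r with hH
  have hHd : ∀ s, HasDerivAt H (G s) s := fun s => (hGc.integral_hasStrictDerivAt 0 s).hasDerivAt
  have hGH : ∀ s ∈ Icc 0 t, G s ≤ M * H s + a := by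
    intro s hs
    have : ∫ r in (0 : ℝ)..s, f r ≤ H s :=
      intervalIntegral.integral_mono_on hs.1 hf.intervalIntegrable (hGc.intervalIntegrable _ _)
        fun r hr => h r ⟨hr.1, hr.2.trans hs.2⟩
    have := mul_le_mul_of_nonneg_left this hM
    simp only [hG]
    linarith
  have key := le_gronwallBound_of_liminf_deriv_right_le (f := H) (f' := G) (δ := 0) (K := M)
    (ε := a) (a := 0) (b := t) (fun s _ => (hHd s).continuousAt.continuousWithinAt)
    (fun s _ r hr => (hHd s).hasDerivWithinAt.liminf_right_slope_le hr) (by simp [hH])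
    (fun s hs => hGH s ⟨hs.1, hs.2.le⟩) t ⟨ht, le_rfl⟩
  have h1 : f t ≤ M * gronwallBound 0 M a t + a := by
    have := mul_le_mul_of_nonneg_left key hM
    rw [sub_zero] at this
    linarith [h t ⟨ht, le_rfl⟩, hGH t ⟨ht, le_rfl⟩]
  rcases eq_or_ne M 0 with rfl | hM0
  · simpa using h1
  · rw [gronwallBound_of_K_ne_0 hM0] at h1
    refine h1.trans_eq ?_
    field_simp
    ring

namespace IsNorm

variable {E : Type*} [NormedAddCommGroup E] [NormedSpace ℝ E] {N : E → ℝ}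

theorem nonneg (hN : IsNorm N) (x : E) : 0 ≤ N x := by
  have h0 := (hN.1 0).2 rfl
  have h1 := hN.2.2 x ((-1 : ℝ) • x)
  have h2 := hN.2.1 (-1) x
  rw [h2, neg_one_smul, add_neg_cancel, h0, abs_neg, abs_one] at h1
  linarith

theorem convexOn (hN : IsNorm N) : ConvexOn ℝ univ N := by
  refine ⟨convex_univ, fun x _ y _ a b ha hb _ => (hN.2.2 _ _).trans_eq ?_⟩
  rw [hN.2.1, hN.2.1, abs_of_nonneg ha, abs_of_nonneg hb, smul_eq_mul, smul_eq_mul]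

theorem continuous [FiniteDimensional ℝ E] (hN : IsNorm N) : Continuous N :=
  continuousOn_univ.1 (hN.convexOn.continuousOn isOpen_univ)

theorem exists_norm_le_mul [FiniteDimensional ℝ E] (hN : IsNorm N) :
    ∃ c, 0 ≤ c ∧ ∀ x, ‖x‖ ≤ c * N x := by
  have : ProperSpace E := FiniteDimensional.proper ℝ E
  have hpos : ∀ x ∈ Metric.sphere (0 : E) 1, 0 < N x := fun x hx =>
    (hN.nonneg x).lt_of_ne' fun h => by
      have := (hN.1 x).1 h
      simp [this] at hx
  obtain ⟨m, hm, hmN⟩ := (isCompact_sphere (0 : E) 1).exists_forall_le' hN.continuous.continuousOn hpos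
  refine ⟨m⁻¹, by positivity, fun x => ?_⟩
  rcases eq_or_ne x 0 with rfl | hx
  · simp [(hN.1 0).2 rfl]
  have hx' : 0 < ‖x‖ := norm_pos_iff.2 hx
  have := hmN (‖x‖⁻¹ • x) (by simp [norm_smul, hx'.ne'])
  rw [hN.2.1, abs_of_pos (by positivity)] at this
  rw [inv_mul_eq_div, le_div_iff₀ hm]
  calc ‖x‖ * m ≤ ‖x‖ * (‖x‖⁻¹ * N x) := by gcongr
    _ = N x := by field_simp

end IsNorm

/-- A continuous induction principle for families that are equicontinuous in time. -/
theorem le_of_bootstrap {ι : Type*} {F : Set ι} {g : ι → ℝ → ℝ} {T L η δ : ℝ} (hδ : 0 < δ)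
    (heq : ∀ u ∈ F, ∀ s ∈ Icc 0 T, ∀ t ∈ Icc 0 T, |s - t| < δ → g u s ≤ g u t + η)
    (himp : ∀ t ∈ Icc 0 T, (∀ u ∈ F, ∀ s ∈ Ico 0 t, g u s ≤ L) → ∀ u ∈ F, g u t ≤ L - η) :
    ∀ u ∈ F, ∀ t ∈ Icc 0 T, g u t ≤ L := by
  have key : ∀ n : ℕ, ∀ u ∈ F, ∀ t ∈ Icc 0 T, t < n * (δ / 2) → g u t ≤ L := by
    intro n
    induction n with
    | zero =>
      intro u _ t ht h
      simp only [Nat.cast_zero, zero_mul] at h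
      exact absurd ht.1 h.not_ge
    | succ n ih =>
      intro u hu s hs hsn
      have ht : max 0 (s - δ / 2) ∈ Icc 0 T :=
        ⟨le_max_left _ _, max_le (hs.1.trans hs.2) (by linarith [hs.2])⟩
      have h1 := himp _ ht (fun v hv r hr => ih v hv r ⟨hr.1, hr.2.le.trans ht.2⟩ (by
        rcases lt_max_iff.1 hr.2 with h | h
        · exact absurd hr.1 h.not_ge
        · push_cast at hsn
          linarith)) u hu
      have h2 := heq u hu s hs _ ht (by
        rw [abs_lt]
        constructor
        · have := max_le hs.1 (show s - δ / 2 ≤ s by linarith)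
          linarith
        · linarith [le_max_right 0 (s - δ / 2)])
      linarith
  intro u hu t ht
  obtain ⟨n, hn⟩ := exists_nat_gt (t / (δ / 2))
  exact key n u hu t ht ((div_lt_iff₀ (by positivity)).1 hn)

theorem exists_bound_of_compact {E : Type*} [NormedAddCommGroup E] {T : ℝ}
    {w : ℝ → ℝ → E} {K : Set ℝ} (hK : IsCompact K)
    (h : ∀ u ∈ K, ∃ R, ∀ᶠ v in 𝓝 u, ∀ t ∈ Icc 0 T, ‖w v t‖ ≤ R) :
    ∃ R, ∀ u ∈ K, ∀ t ∈ Icc 0 T, ‖w u t‖ ≤ R := by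
  refine hK.induction_on (p := fun s => ∃ R, ∀ u ∈ s, ∀ t ∈ Icc 0 T, ‖w u t‖ ≤ R) ⟨0, by simp⟩
    (fun s s' hs ⟨R, hR⟩ => ⟨R, fun u hu => hR u (hs hu)⟩) ?_ ?_
  · rintro s s' ⟨R, hR⟩ ⟨R', hR'⟩
    refine ⟨max R R', ?_⟩
    rintro u (hu | hu) t ht
    · exact (hR u hu t ht).trans (le_max_left _ _)
    · exact (hR' u hu t ht).trans (le_max_right _ _)
  · intro u hu
    obtain ⟨R, hR⟩ := h u hu
    exact ⟨_, mem_nhdsWithin_of_mem_nhds hR, R, fun v hv => hv⟩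

section Bound

variable {E : Type*} [NormedAddCommGroup E] [NormedSpace ℝ E] {T : ℝ} {w D : ℝ → ℝ → E}

/-- If `w` is bounded on `F × [0, T]` and one path is small, then all of them are. -/
theorem norm_le_of_convex_compact (hws : ∀ u, ContinuousOn (w u) (Icc 0 T))
    (hD : ∀ t ∈ Icc 0 T, ∀ u, HasDerivAt (fun u => w u t) (D u t) u)
    (hP : ∀ R, ∃ C, ∀ u, ∀ t ∈ Icc 0 T, (∀ s ∈ Ico 0 t, ‖w u s‖ ≤ R) → ‖D u t‖ ≤ C)
    {F : Set ℝ} (hF : Convex ℝ F) (hFc : IsCompact F) {R' : ℝ}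
    (hR' : ∀ u ∈ F, ∀ t ∈ Icc 0 T, ‖w u t‖ ≤ R') {R C ρ e : ℝ} (he : e ∈ F)
    (hC0 : 0 ≤ C)
    (hC : ∀ u, ∀ t ∈ Icc 0 T, (∀ s ∈ Ico 0 t, ‖w u s‖ ≤ R + 2) → ‖D u t‖ ≤ C)
    (hρ : C * ρ ≤ 1 / 2) (hFe : ∀ u ∈ F, |u - e| ≤ ρ)
    {t : ℝ} (ht : t ∈ Icc 0 T) (hwe : ∀ s ∈ Icc 0 t, ‖w e s‖ ≤ R + 1) :
    ∀ u ∈ F, ∀ s ∈ Icc 0 t, ‖w u s‖ ≤ R + 2 := by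
  obtain ⟨C', hC'⟩ := hP R'
  have hcont : ContinuousOn (fun p : ℝ × ℝ => w p.1 p.2) (F ×ˢ Icc 0 T) := by
    refine continuousOn_prod_of_continuousOn_lipschitzOnWith _ C'.toNNReal (fun u _ => hws u)
      fun s hs => ?_
    refine hF.lipschitzOnWith_of_nnnorm_hasDerivWithin_le
      (fun u _ => (hD s hs u).hasDerivWithinAt) fun u hu => ?_
    rw [← NNReal.coe_le_coe, coe_nnnorm]
    exact (hC' u s hs fun r hr => hR' u hu r ⟨hr.1, hr.2.le.trans hs.2⟩).trans
      (Real.le_coe_toNNReal _)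
  obtain ⟨δ, hδ, hδw⟩ := Metric.uniformContinuousOn_iff.1
    ((hFc.prod isCompact_Icc).uniformContinuousOn_of_continuous hcont) (1 / 2) (by norm_num)
  have hsub : Icc 0 t ⊆ Icc 0 T := Icc_subset_Icc_right ht.2
  refine le_of_bootstrap (η := 1 / 2) hδ (fun u hu s hs r hr hsr => ?_) fun r hr hle u hu => ?_
  · have := hδw (u, s) ⟨hu, hsub hs⟩ (u, r) ⟨hu, hsub hr⟩ (by simpa [Prod.dist_eq, hδ, Real.dist_eq] using hsr)
    rw [dist_eq_norm] at this
    have h2 := norm_le_norm_add_norm_sub' (w u s) (w u r)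
    simp only at this
    linarith
  · have h1 := hF.norm_image_sub_le_of_norm_hasDerivWithin_le (C := C)
      (fun v _ => (hD r (hsub hr) v).hasDerivWithinAt)
      (fun v hv => hC v r (hsub hr) (hle v hv)) he hu
    have h2 := norm_le_norm_add_norm_sub' (w u r) (w e r)
    have h3 : C * ‖u - e‖ ≤ C * ρ := mul_le_mul_of_nonneg_left (hFe u hu) hC0
    linarith [hwe r hr]

/-- The set of parameters near which `w` is unbounded is empty, by the Baire category theorem. -/
theorem eventually_bounded (hws : ∀ u, ContinuousOn (w u) (Icc 0 T))
    (hD : ∀ t ∈ Icc 0 T, ∀ u, HasDerivAt (fun u => w u t) (D u t) u)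
    (hP : ∀ R, ∃ C, ∀ u, ∀ t ∈ Icc 0 T, (∀ s ∈ Ico 0 t, ‖w u s‖ ≤ R) → ‖D u t‖ ≤ C) (u₀ : ℝ) :
    ∃ R, ∀ᶠ v in 𝓝 u₀, ∀ t ∈ Icc 0 T, ‖w v t‖ ≤ R := by
  set B : Set ℝ := {u | ¬ ∃ R, ∀ᶠ v in 𝓝 u, ∀ t ∈ Icc 0 T, ‖w v t‖ ≤ R}
  have hBclosed : IsClosed B := by
    rw [← isOpen_compl_iff, isOpen_iff_mem_nhds]
    intro u hu
    obtain ⟨R, hR⟩ := not_not.1 hu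
    filter_upwards [eventually_eventually_nhds.2 hR] with v hv
    exact not_not.2 ⟨R, hv⟩
  by_contra hu₀
  have hne : Nonempty B := ⟨⟨u₀, hu₀⟩⟩
  have : CompleteSpace B := hBclosed.completeSpace_coe
  obtain ⟨n, ⟨x, hxB⟩, hx⟩ := nonempty_interior_of_iUnion_of_closed
    (f := fun n : ℕ => {u : B | ∀ t ∈ Icc 0 T, ‖w u t‖ ≤ n})
    (fun n => by
      simp only [ofPred_forall]
      refine isClosed_biInter fun t ht => isClosed_le ?_ continuous_const
      have : Continuous fun u => w u t :=
        continuous_iff_continuousAt.2 fun u => (hD t ht u).continuousAt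
      fun_prop)
    (by
      refine eq_univ_of_forall fun u => mem_iUnion.2 ?_
      obtain ⟨M, hM⟩ := isCompact_Icc.exists_bound_of_continuousOn (hws u)
      obtain ⟨n, hn⟩ := exists_nat_ge M
      exact ⟨n, fun t ht => (hM t ht).trans hn⟩)
  obtain ⟨r, hr, hball⟩ := Metric.mem_nhds_iff.1 (mem_interior_iff_mem_nhds.1 hx)
  set R : ℝ := (n : ℝ)
  have hBR : ∀ a ∈ B, |a - x| < r → ∀ t ∈ Icc 0 T, ‖w a t‖ ≤ R := fun a ha hax =>
    hball (show (⟨a, ha⟩ : B) ∈ Metric.ball ⟨x, hxB⟩ r from hax)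
  obtain ⟨C₁, hC₁⟩ := hP (R + 2)
  set C := max C₁ 1
  have hC : ∀ u, ∀ t ∈ Icc 0 T, (∀ s ∈ Ico 0 t, ‖w u s‖ ≤ R + 2) → ‖D u t‖ ≤ C :=
    fun u t ht h => (hC₁ u t ht h).trans (le_max_left _ _)
  have hCpos : 0 < C := one_pos.trans_le (le_max_right _ _)
  set ε := min (r / 2) (1 / (2 * C))
  have hε : 0 < ε := by positivity
  have hεr : ε ≤ r / 2 := min_le_left _ _
  have hεC : C * ε ≤ 1 / 2 := by
    calc C * ε ≤ C * (1 / (2 * C)) := by gcongr; exact min_le_right _ _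
      _ = 1 / 2 := by field_simp
  refine hxB ⟨R + 1, ?_⟩
  filter_upwards [Metric.ball_mem_nhds x hε] with e hex
  rw [Metric.mem_ball, Real.dist_eq] at hex
  obtain ⟨a, haB, hea⟩ := hBclosed.exists_infDist_eq_dist ⟨x, hxB⟩ e
  have hmin : ∀ b ∈ B, |e - a| ≤ |e - b| := fun b hb => by
    have := Metric.infDist_le_dist_of_mem (x := e) hb
    rwa [hea, Real.dist_eq, Real.dist_eq] at this
  have hea' : |e - a| ≤ ε := (hmin x hxB).trans hex.le
  have hax : |a - x| < r := by
    have := abs_sub_le a e x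
    rw [abs_sub_comm a e] at this
    linarith
  have haR := hBR a haB hax
  have hsmall : ∀ t ∈ Icc 0 T, (∀ s ∈ Ico 0 t, ‖w e s‖ ≤ R + 1) → ‖w e t‖ ≤ R + 1 / 2 := by
    intro t ht hlt
    have hbd : ∀ u ∈ uIcc a e, ∀ s ∈ Ico 0 t, ‖w u s‖ ≤ R + 2 := by
      intro u hu s hs
      have hsT : s ∈ Icc 0 T := ⟨hs.1, hs.2.le.trans ht.2⟩
      rcases eq_or_ne u a with rfl | hua
      · linarith [haR s hsT]
      have hlt' : ∀ v ∈ uIcc u e, |v - e| < |e - a| := fun v hv => by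
        have h1 : |v - e| ≤ |u - e| := by
          rw [abs_sub_comm v e, abs_sub_comm u e]
          exact abs_sub_right_of_mem_uIcc hv
        refine h1.trans_lt ?_
        rcases le_total a e with h | h
        · rw [uIcc_of_le h] at hu
          have := lt_of_le_of_ne hu.1 hua.symm
          rw [abs_of_nonpos (by linarith [hu.2]), abs_of_nonneg (by linarith)]
          linarith
        · rw [uIcc_of_ge h] at hu
          have := lt_of_le_of_ne hu.2 hua
          rw [abs_of_nonneg (by linarith [hu.1]), abs_of_nonpos (by linarith)]
          linarith
      obtain ⟨R', hR'⟩ := exists_bound_of_compact (w := w) (T := T) (isCompact_uIcc (a := u) (b := e))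
        fun v hv => by
          by_contra hvB
          have := hmin v hvB
          rw [abs_sub_comm e v] at this
          exact this.not_gt (hlt' v hv)
      exact norm_le_of_convex_compact hws hD hP (convex_uIcc u e) isCompact_uIcc hR' right_mem_uIcc
        hCpos.le hC hεC (fun v hv => (hlt' v hv).le.trans hea') hsT
        (fun q hq => hlt q ⟨hq.1, hq.2.trans_lt hs.2⟩) u left_mem_uIcc s ⟨hs.1, le_rfl⟩
    have h1 := (convex_uIcc a e).norm_image_sub_le_of_norm_hasDerivWithin_le (C := C)
      (fun v _ => (hD t ht v).hasDerivWithinAt)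
      (fun v hv => hC v t ht (hbd v hv)) left_mem_uIcc right_mem_uIcc
    have h2 := norm_le_norm_add_norm_sub' (w e t) (w a t)
    have h3 : C * ‖e - a‖ ≤ C * ε := mul_le_mul_of_nonneg_left hea' hCpos.le
    linarith [haR t ht]
  obtain ⟨δ, hδ, hδw⟩ := Metric.uniformContinuousOn_iff.1
    (isCompact_Icc.uniformContinuousOn_of_continuous (hws e)) (1 / 2) (by norm_num)
  refine le_of_bootstrap (F := {e}) (g := fun v t => ‖w v t‖) (η := 1 / 2) hδ ?_ ?_ e rfl
  · intro v hv s hs t ht hst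
    rw [mem_singleton_iff.1 hv]
    have := hδw s hs t ht hst
    rw [dist_eq_norm] at this
    have h2 := norm_le_norm_add_norm_sub' (w e s) (w e t)
    linarith
  · rintro t ht h _ rfl
    have := hsmall t ht (h _ rfl)
    linarith

end Bound

theorem measurable_fderiv_apply_of_continuousOn {E : Type*} [NormedAddCommGroup E]
    [NormedSpace ℝ E] [MeasurableSpace E] [BorelSpace E] {T : ℝ} {z : E → ℝ → E}
    (hzc : ∀ x, ContinuousOn (z x) (Icc 0 T))
    (hz : ∀ t ∈ Icc 0 T, Differentiable ℝ fun x => z x t) (x h : E) :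
    Measurable fun s : Icc (0 : ℝ) T => fderiv ℝ (fun y => z y (s : ℝ)) x h := by
  have hc : ∀ x, Continuous fun s : Icc (0 : ℝ) T => z x s := fun x =>
    continuousOn_iff_continuous_domRestrict.1 (hzc x)
  refine measurable_of_tendsto_metrizable
    (f := fun (n : ℕ) (s : Icc (0 : ℝ) T) => (n : ℝ) • (z (x + (n : ℝ)⁻¹ • h) s - z x s))
    (fun n => (((hc _).sub (hc _)).const_smul _).measurable) (tendsto_pi_nhds.2 fun s => ?_)
  refine (hz s s.2 x).hasFDerivAt.lim h (c := fun n : ℕ => (n : ℝ)) (l := atTop) ?_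
  simpa using tendsto_natCast_atTop_atTop (R := ℝ)

theorem norm_fderiv_le_exp {E : Type*} [NormedAddCommGroup E] [NormedSpace ℝ E]
    [FiniteDimensional ℝ E] [MeasurableSpace E] [BorelSpace E] {T : ℝ} {φ : E → ℝ}
    (hφc : Continuous φ) {N : E → ℝ} (hN : IsNorm N)
    {z : E → ℝ → E} (hzc : ∀ x, ContinuousOn (z x) (Icc 0 T))
    (hz : ∀ t ∈ Icc 0 T, Differentiable ℝ fun x => z x t) {x h : E}
    (hint : (∫⁻ s in Icc (0 : ℝ) T, ENNReal.ofReal (N (fderiv ℝ (fun y => z y s) x h))) < ⊤)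
    (hle : ∀ t ∈ Icc (0 : ℝ) T, N (fderiv ℝ (fun y => z y t) x h) ≤
      N h + ∫ s in (0 : ℝ)..t, φ (z x s) * N (fderiv ℝ (fun y => z y s) x h))
    {t M : ℝ} (ht : t ∈ Icc 0 T) (hM : 0 ≤ M) (hφM : ∀ s ∈ Ico 0 t, φ (z x s) ≤ M) :
    N (fderiv ℝ (fun y => z y t) x h) ≤ N h * Real.exp (M * t) := by
  set f : ℝ → ℝ := fun s => N (fderiv ℝ (fun y => z y s) x h)
  have hfm : AEMeasurable f (volume.restrict (Icc 0 T)) :=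
    aemeasurable_restrict_of_measurable_subtype measurableSet_Icc
      (hN.continuous.measurable.comp (measurable_fderiv_apply_of_continuousOn hzc hz x h))
  have hfi : IntegrableOn f (Icc 0 T) :=
    ⟨hfm.aestronglyMeasurable, (hasFiniteIntegral_iff_ofReal
      (Eventually.of_forall fun s => hN.nonneg _)).2 hint⟩
  have hfφ : IntegrableOn (fun s => φ (z x s) * f s) (Icc 0 T) :=
    hfi.continuousOn_mul (hφc.comp_continuousOn (hzc x)) isCompact_Icc
  have hind : ∀ s ∈ Icc 0 T, (Icc 0 T).indicator f s = f s := fun s hs => indicator_of_mem hs f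
  have := integral_gronwall (f := (Icc 0 T).indicator f) (a := N h) hM ht.1
    ((integrable_indicator_iff measurableSet_Icc).2 hfi) fun s hs => ?_
  · rwa [hind t ht] at this
  have hsT : s ∈ Icc 0 T := ⟨hs.1, hs.2.trans ht.2⟩
  have hsub : Icc 0 s ⊆ Icc 0 T := Icc_subset_Icc_right hsT.2
  rw [hind s hsT]
  refine (hle s hsT).trans (add_le_add_right ?_ _)
  rw [← intervalIntegral.integral_const_mul]
  refine intervalIntegral.integral_mono_on_of_le_Ioo hs.1
    ((intervalIntegrable_iff_integrableOn_Icc_of_le hs.1).2 (hfφ.mono_set hsub))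
    (((integrable_indicator_iff measurableSet_Icc).2 hfi).const_mul M).intervalIntegrable
    fun r hr => ?_
  rw [hind r (hsub ⟨hr.1.le, hr.2.le⟩)]
  exact mul_le_mul_of_nonneg_right (hφM r ⟨hr.1.le, hr.2.trans_le hs.2⟩) (hN.nonneg _)

end

/-- **Lemma (conditional local Lipschitz continuity for deterministic
differential equations).** -/
theorem conditional_local_lipschitz_dde
    (d : ℕ) (hd : 0 < d) (T : ℝ) (hT : 0 ≤ T)
    (φ : (Fin d → ℝ) → ℝ) (hφc : Continuous φ) (hφ0 : ∀ x, 0 ≤ φ x)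
    (Nd : (Fin d → ℝ) → ℝ) (hNd : IsNorm Nd)
    (z : (Fin d → ℝ) → ℝ → (Fin d → ℝ))
    (hzc : ∀ x, ContinuousOn (z x) (Set.Icc (0 : ℝ) T))
    (hzC1 : ∀ t ∈ Set.Icc (0 : ℝ) T, ContDiff ℝ 1 (fun x => z x t))
    (hder : ∀ x h : Fin d → ℝ,
      Measurable (fun s : Set.Icc (0 : ℝ) T =>
        fderiv ℝ (fun y => z y (s : ℝ)) x h) →
      ((∫⁻ s in Set.Icc (0 : ℝ) T,
          ENNReal.ofReal (Nd (fderiv ℝ (fun y => z y s) x h))) < ⊤ ∧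
        ∀ t ∈ Set.Icc (0 : ℝ) T,
          Nd (fderiv ℝ (fun y => z y t) x h) ≤
            Nd h + ∫ s in (0 : ℝ)..t,
              φ (z x s) * Nd (fderiv ℝ (fun y => z y s) x h))) :
    ∀ x y : Fin d → ℝ, ∀ t ∈ Set.Icc (0 : ℝ) T,
      Nd (z x t - z y t) ≤
        sSup ((fun u : ℝ => Nd (x - y) * Real.exp (T *
          sSup ((fun s => φ (z ((1 - u) • y + u • x) s)) '' Set.Icc (0 : ℝ) T)))
          '' Set.Icc (0 : ℝ) 1) := by
  intro x y t ht
  have hz : ∀ t ∈ Set.Icc (0 : ℝ) T, Differentiable ℝ fun x => z x t := fun t ht =>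
    (hzC1 t ht).differentiable one_ne_zero
  have hgron : ∀ (p : Fin d → ℝ) {t M : ℝ}, t ∈ Set.Icc 0 T → 0 ≤ M →
      (∀ s ∈ Set.Ico 0 t, φ (z p s) ≤ M) →
      Nd (fderiv ℝ (fun q => z q t) p (x - y)) ≤ Nd (x - y) * Real.exp (T * M) := by
    intro p t M ht hM hφM
    have hh := hder p (x - y) (measurable_fderiv_apply_of_continuousOn hzc hz p (x - y))
    refine (norm_fderiv_le_exp hφc hNd hzc hz hh.1 hh.2 ht hM hφM).trans ?_
    refine mul_le_mul_of_nonneg_left (Real.exp_le_exp.2 ?_) (hNd.nonneg _)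
    rw [mul_comm]
    exact mul_le_mul_of_nonneg_right ht.2 hM
  set γ : ℝ → Fin d → ℝ := fun u => (1 - u) • y + u • x with hγ
  have hγd : ∀ u, HasDerivAt γ (x - y) u := fun u => by
    have := (((hasDerivAt_id u).const_sub 1).smul_const y).add ((hasDerivAt_id u).smul_const x)
    refine this.congr_deriv ?_
    rw [neg_one_smul, one_smul, neg_add_eq_sub]
  have hγc : Continuous γ := continuous_iff_continuousAt.2 fun u => (hγd u).continuousAt
  set D : ℝ → ℝ → Fin d → ℝ := fun u t => fderiv ℝ (fun q => z q t) (γ u) (x - y)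
  have hD : ∀ t ∈ Set.Icc 0 T, ∀ u, HasDerivAt (fun u => z (γ u) t) (D u t) u := fun t ht u =>
    (hz t ht (γ u)).hasFDerivAt.comp_hasDerivAt u (hγd u)
  have hball : ∀ R : ℝ, ∃ M, 0 ≤ M ∧ ∀ v : Fin d → ℝ, ‖v‖ ≤ R → φ v ≤ M := by
    intro R
    obtain ⟨M, hM⟩ := (isCompact_closedBall (0 : Fin d → ℝ) R).exists_bound_of_continuousOn
      hφc.continuousOn
    exact ⟨max M 0, le_max_right _ _, fun v hv => (le_abs_self _).trans
      ((hM v (mem_closedBall_zero_iff.2 hv)).trans (le_max_left _ _))⟩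
  obtain ⟨c, hc0, hc⟩ := hNd.exists_norm_le_mul
  have hP : ∀ R, ∃ C, ∀ u, ∀ t ∈ Set.Icc 0 T, (∀ s ∈ Set.Ico 0 t, ‖z (γ u) s‖ ≤ R) →
      ‖D u t‖ ≤ C := by
    intro R
    obtain ⟨M, hM0, hM⟩ := hball R
    exact ⟨c * (Nd (x - y) * Real.exp (T * M)), fun u t ht h => (hc _).trans
      (mul_le_mul_of_nonneg_left (hgron (γ u) ht hM0 fun s hs => hM _ (h s hs)) hc0)⟩
  obtain ⟨R, hR⟩ := exists_bound_of_compact (w := fun u => z (γ u)) (T := T)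
    (isCompact_Icc (a := (0 : ℝ)) (b := 1))
    fun u _ => eventually_bounded (fun u => hzc (γ u)) hD hP u
  obtain ⟨M, hM0, hM⟩ := hball R
  have hbdd : BddAbove ((fun u : ℝ => Nd (x - y) * Real.exp (T *
      sSup ((fun s => φ (z (γ u) s)) '' Set.Icc (0 : ℝ) T))) '' Set.Icc (0 : ℝ) 1) := by
    refine ⟨Nd (x - y) * Real.exp (T * M), ?_⟩
    rintro _ ⟨u, hu, rfl⟩
    refine mul_le_mul_of_nonneg_left (Real.exp_le_exp.2
      (mul_le_mul_of_nonneg_left (Real.sSup_le ?_ hM0) hT)) (hNd.nonneg _)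
    rintro _ ⟨s, hs, rfl⟩
    exact hM _ (hR u hu s hs)
  set S := sSup ((fun u : ℝ => Nd (x - y) * Real.exp (T *
      sSup ((fun s => φ (z (γ u) s)) '' Set.Icc (0 : ℝ) T))) '' Set.Icc (0 : ℝ) 1)
  have hDS : ∀ u ∈ Set.Icc (0 : ℝ) 1, Nd (D u t) ≤ S := by
    intro u hu
    have hφbdd : BddAbove ((fun s => φ (z (γ u) s)) '' Set.Icc (0 : ℝ) T) :=
      (isCompact_Icc.image_of_continuousOn (hφc.comp_continuousOn (hzc (γ u)))).bddAbove
    have hφnonneg : 0 ≤ sSup ((fun s => φ (z (γ u) s)) '' Set.Icc (0 : ℝ) T) := by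
      refine Real.sSup_nonneg ?_
      rintro _ ⟨s, _, rfl⟩
      exact hφ0 _
    exact (hgron (γ u) ht hφnonneg fun s hs =>
      le_csSup hφbdd ⟨s, ⟨hs.1, hs.2.le.trans ht.2⟩, rfl⟩).trans (le_csSup hbdd ⟨u, hu, rfl⟩)
  have hDc : Continuous fun u => D u t :=
    (((hzC1 t ht).continuous_fderiv one_ne_zero).comp hγc).clm_apply continuous_const
  have hftc : ∫ u in (0 : ℝ)..1, D u t = z x t - z y t := by
    rw [intervalIntegral.integral_eq_sub_of_hasDerivAt (fun u _ => hD t ht u)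
      (hDc.intervalIntegrable _ _)]
    simp [hγ]
  have hprob : IsProbabilityMeasure (volume.restrict (Set.Ioc (0 : ℝ) 1)) :=
    ⟨by simp⟩
  have hmem : ∫ u in Set.Ioc (0 : ℝ) 1, D u t ∈ {v | Nd v ≤ S} := by
    refine Convex.integral_mem (by simpa using hNd.convexOn.convex_le S)
      (isClosed_le hNd.continuous continuous_const) ?_ (hDc.integrableOn_Ioc)
    exact (ae_restrict_mem measurableSet_Ioc).mono fun u hu => hDS u ⟨hu.1.le, hu.2⟩
  rw [← intervalIntegral.integral_of_le zero_le_one, hftc] at hmem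
  exact hmem
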